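/- arXiv:2406.01793 — 4 statements merged into one kernel-verified Lean document; each statement's English description precedes it below -/
import Mathlib

section
/- Let μ₁, μ₂ ∈ M and suppose ν_i(s) = Σ_a μ_i(s,a) ≥ ν_min > 0 for all s ∈ S and i = 1,2. Then (1−γ)·Σ_{s,a}|μ₁(s,a)−μ₂(s,a)| ≤ max_{s∈S} Σ_a |π^{μ₁}(a|s) − π^{μ₂}(a|s)| ≤ (2/ν_min)·Σ_{s,a}|μ₁(s,a)−μ₂(s,a)|. -/
noncomputable section
open scoped BigOperators

/-- The set of occupancy measures: `μ ≥ 0` componentwise and `(E − γP)ᵀμ = (1−γ)ν₀`. -/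
def occSet {S A : Type*} [Fintype S] [Fintype A]
    (γ : ℝ) (ν₀ : S → ℝ) (P : S → A → S → ℝ) : Set (S → A → ℝ) :=
  {μ | (∀ s a, 0 ≤ μ s a) ∧
    ∀ s', (∑ a, μ s' a) - γ * ∑ s, ∑ a, P s a s' * μ s a = (1 - γ) * ν₀ s'}

theorem sum_sub_sum_mem_occSet {S A : Type*} [Fintype S] [Fintype A]
    {γ : ℝ} {ν₀ : S → ℝ} {P : S → A → S → ℝ} {μ₁ μ₂ : S → A → ℝ}
    (hμ₁ : μ₁ ∈ occSet γ ν₀ P) (hμ₂ : μ₂ ∈ occSet γ ν₀ P) (s' : S) :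
    (∑ a, μ₁ s' a) - ∑ a, μ₂ s' a = γ * ∑ s, ∑ a, P s a s' * (μ₁ s a - μ₂ s a) := by
  simp only [mul_sub, Finset.sum_sub_distrib]
  linarith [hμ₁.2 s', hμ₂.2 s']

theorem sum_sum_transition_mul {S A : Type*} [Fintype S] [Fintype A] {P : S → A → S → ℝ}
    (hP : ∀ s a, ∑ s', P s a s' = 1) (f : S → A → ℝ) :
    ∑ s', ∑ s, ∑ a, P s a s' * f s a = ∑ s, ∑ a, f s a := by
  rw [Finset.sum_comm]
  refine Finset.sum_congr rfl fun s _ => ?_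
  rw [Finset.sum_comm]
  refine Finset.sum_congr rfl fun a _ => ?_
  rw [← Finset.sum_mul, hP, one_mul]

theorem sum_sum_eq_one_of_mem_occSet {S A : Type*} [Fintype S] [Fintype A]
    {γ : ℝ} (hγ : γ < 1) {ν₀ : S → ℝ} (hν₀ : ∑ s, ν₀ s = 1) {P : S → A → S → ℝ}
    (hP : ∀ s a, ∑ s', P s a s' = 1) {μ : S → A → ℝ} (hμ : μ ∈ occSet γ ν₀ P) :
    ∑ s, ∑ a, μ s a = 1 := by
  have h := Finset.sum_congr rfl fun s (_ : s ∈ Finset.univ) => hμ.2 s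
  rw [Finset.sum_sub_distrib, ← Finset.mul_sum, ← Finset.mul_sum,
    sum_sum_transition_mul hP, hν₀] at h
  have hγ' : 1 - γ ≠ 0 := by linarith
  exact mul_left_cancel₀ hγ' (by linarith)

/-- The state marginals of two occupancy measures are `γ` times closer than the measures. -/
theorem sum_abs_marginal_sub_le {S A : Type*} [Fintype S] [Fintype A]
    {γ : ℝ} (hγ : 0 ≤ γ) {ν₀ : S → ℝ} {P : S → A → S → ℝ}
    (hP₀ : ∀ s a s', 0 ≤ P s a s') (hP : ∀ s a, ∑ s', P s a s' = 1) {μ₁ μ₂ : S → A → ℝ}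
    (hμ₁ : μ₁ ∈ occSet γ ν₀ P) (hμ₂ : μ₂ ∈ occSet γ ν₀ P) :
    ∑ s, |(∑ a, μ₁ s a) - ∑ a, μ₂ s a| ≤ γ * ∑ s, ∑ a, |μ₁ s a - μ₂ s a| := by
  rw [← sum_sum_transition_mul hP fun s a => |μ₁ s a - μ₂ s a|, Finset.mul_sum]
  refine Finset.sum_le_sum fun s' _ => ?_
  rw [sum_sub_sum_mem_occSet hμ₁ hμ₂, abs_mul, abs_of_nonneg hγ]
  gcongr
  refine (Finset.abs_sum_le_sum_abs _ _).trans (Finset.sum_le_sum fun s _ => ?_)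
  refine (Finset.abs_sum_le_sum_abs _ _).trans (Finset.sum_le_sum fun a _ => ?_)
  rw [abs_mul, abs_of_nonneg (hP₀ s a s')]

/-- For vectors `p`, `q` with `q ≥ 0` and positive total masses, rescaling the `ℓ¹` distance of
the normalized vectors by the mass of `p` changes the distance of `p` and `q` by at most the
difference of the masses. -/
theorem abs_sum_abs_sub_sub_mul_sum_abs_div_sub_div_le {A : Type*} [Fintype A] {p q : A → ℝ}
    (hq : ∀ a, 0 ≤ q a) (hp_pos : 0 < ∑ a, p a) (hq_pos : 0 < ∑ a, q a) :
    |(∑ a, |p a - q a|) - (∑ a, p a) * (∑ a, |p a / (∑ a', p a') - q a / (∑ a', q a')|)| ≤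
      |(∑ a, p a) - ∑ a, q a| := by
  set m := ∑ a, p a
  set n := ∑ a, q a with hn
  have h_sum : |m - n| = ∑ a, |m - n| * (q a / n) := by
    rw [← Finset.mul_sum, ← Finset.sum_div, ← hn, div_self hq_pos.ne', mul_one]
  rw [h_sum, Finset.mul_sum, ← Finset.sum_sub_distrib]
  refine (Finset.abs_sum_le_sum_abs _ _).trans (Finset.sum_le_sum fun a _ => ?_)
  rw [← abs_of_pos hp_pos, ← abs_mul, abs_of_pos hp_pos,
    ← abs_of_nonneg (div_nonneg (hq a) hq_pos.le), ← abs_mul,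
    abs_of_nonneg (div_nonneg (hq a) hq_pos.le)]
  refine (abs_abs_sub_abs_le _ _).trans_eq (congrArg _ ?_)
  field_simp
  ring

/-- For occupancy measures `μ₁, μ₂ ∈ M` with `ν_i(s) ≥ ν_min > 0`,
`(1−γ)·‖μ₁−μ₂‖₁ ≤ max_s ‖π^{μ₁}(·|s) − π^{μ₂}(·|s)‖₁ ≤ (2/ν_min)·‖μ₁−μ₂‖₁`. -/
theorem stmt0 {S A : Type*} [Fintype S] [Fintype A] [Nonempty S] [Nonempty A]
    (hcardS : 1 < Fintype.card S) (hcardA : 1 < Fintype.card A)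
    (γ : ℝ) (hγ : γ ∈ Set.Ioo (0 : ℝ) 1)
    (ν₀ : S → ℝ) (hν₀ : (∀ s, 0 ≤ ν₀ s) ∧ ∑ s, ν₀ s = 1)
    (P : S → A → S → ℝ)
    (hP : (∀ s a s', 0 ≤ P s a s') ∧ ∀ s a, ∑ s', P s a s' = 1)
    (μ₁ μ₂ : S → A → ℝ)
    (hμ₁ : μ₁ ∈ occSet γ ν₀ P) (hμ₂ : μ₂ ∈ occSet γ ν₀ P)
    (νmin : ℝ) (hνmin : 0 < νmin)
    (hb₁ : ∀ s, νmin ≤ ∑ a, μ₁ s a) (hb₂ : ∀ s, νmin ≤ ∑ a, μ₂ s a) :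
    (1 - γ) * (∑ s, ∑ a, |μ₁ s a - μ₂ s a|) ≤
      (Finset.univ.sup' Finset.univ_nonempty fun s =>
        ∑ a, |μ₁ s a / (∑ a', μ₁ s a') - μ₂ s a / (∑ a', μ₂ s a')|) ∧
    (Finset.univ.sup' Finset.univ_nonempty fun s =>
        ∑ a, |μ₁ s a / (∑ a', μ₁ s a') - μ₂ s a / (∑ a', μ₂ s a')|) ≤
      (2 / νmin) * (∑ s, ∑ a, |μ₁ s a - μ₂ s a|) := by
  have hdist s := abs_le.1 (abs_sum_abs_sub_sub_mul_sum_abs_div_sub_div_le (hμ₂.1 s)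
    (hνmin.trans_le (hb₁ s)) (hνmin.trans_le (hb₂ s)))
  constructor
  · set D := Finset.univ.sup' Finset.univ_nonempty fun s =>
      ∑ a, |μ₁ s a / (∑ a', μ₁ s a') - μ₂ s a / (∑ a', μ₂ s a')|
    have hle : ∑ s, ∑ a, |μ₁ s a - μ₂ s a| ≤
        ∑ s, ((∑ a, μ₁ s a) * D + |(∑ a, μ₁ s a) - ∑ a, μ₂ s a|) := by
      refine Finset.sum_le_sum fun s _ => ?_
      have hD : ∑ a, |μ₁ s a / (∑ a', μ₁ s a') - μ₂ s a / (∑ a', μ₂ s a')| ≤ D :=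
        Finset.le_sup' (fun s => ∑ a, |μ₁ s a / (∑ a', μ₁ s a') - μ₂ s a / (∑ a', μ₂ s a')|)
          (Finset.mem_univ s)
      have hmul := mul_le_mul_of_nonneg_left hD (hνmin.le.trans (hb₁ s))
      linarith [(hdist s).2]
    rw [Finset.sum_add_distrib, ← Finset.sum_mul,
      sum_sum_eq_one_of_mem_occSet hγ.2 hν₀.2 hP.2 hμ₁] at hle
    linarith [sum_abs_marginal_sub_le hγ.1.le hP.1 hP.2 hμ₁ hμ₂]
  · refine Finset.sup'_le _ _ fun s _ => ?_
    have hmarg : |(∑ a, μ₁ s a) - ∑ a, μ₂ s a| ≤ ∑ a, |μ₁ s a - μ₂ s a| := by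
      rw [← Finset.sum_sub_distrib]
      exact Finset.abs_sum_le_sum_abs _ _
    have hsingle : ∑ a, |μ₁ s a - μ₂ s a| ≤ ∑ s, ∑ a, |μ₁ s a - μ₂ s a| :=
      Finset.single_le_sum (f := fun s => ∑ a, |μ₁ s a - μ₂ s a|)
        (fun _ _ => Finset.sum_nonneg fun _ _ => abs_nonneg _) (Finset.mem_univ s)
    have hmul := mul_le_mul_of_nonneg_right (hb₁ s)
      (Finset.sum_nonneg fun a (_ : a ∈ Finset.univ) =>
        abs_nonneg (μ₁ s a / (∑ a', μ₁ s a') - μ₂ s a / (∑ a', μ₂ s a')))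
    rw [div_mul_eq_mul_div, le_div_iff₀ hνmin, mul_comm]
    linarith [(hdist s).1]
end
end

section
/- Let h(p) = τ·Σ_a p(a)·log p(a) (negative Shannon entropy, with 0·log 0 = 0) for some τ > 0, and let r ∈ ℝ^{S×A} with r_max = max_{s,a}|r(s,a)|. Suppose the exploration assumption holds, and let μ* be a maximizer of J(r,·) over M. Then for every s ∈ S and a ∈ A, π^{μ*}(a|s) ≥ exp(−2·r_max/(τ·(1−γ))) / |A|^{1 + 1/(1−γ)} (with a real exponent 1 + 1/(1−γ)). -/
noncomputable section
open scoped BigOperators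

/-- The policy corresponding to an occupancy measure. -/
def pol {S A : Type*} [Fintype A] (μ : S → A → ℝ) (s : S) : A → ℝ :=
  fun a => μ s a / ∑ a', μ s a'

/-- The regularized objective `J(r,μ) = ⟨r,μ⟩ − h̄(μ)` for the negative Shannon entropy
regularizer `h(p) = τ·Σ_a p(a)·log p(a)` (with `0·log 0 = 0`, as `Real.log 0 = 0`). -/
def Jshannon {S A : Type*} [Fintype S] [Fintype A]
    (τ : ℝ) (r μ : S → A → ℝ) : ℝ :=
  (∑ s, ∑ a, r s a * μ s a) -
    ∑ s, (∑ a, μ s a) * (τ * ∑ a, pol μ s a * Real.log (pol μ s a))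

/-- The state-action values `r + γ P v` of a state value function `v`. -/
def qValue {S A : Type*} [Fintype S] (γ : ℝ) (P : S → A → S → ℝ) (r : S → A → ℝ)
    (v : S → ℝ) (s : S) (a : A) : ℝ :=
  r s a + γ * ∑ s', P s a s' * v s'

/-- The entropy-regularized Bellman optimality operator. -/
def softBellman {S A : Type*} [Fintype S] [Fintype A] (γ τ : ℝ) (P : S → A → S → ℝ)
    (r : S → A → ℝ) (v : S → ℝ) (s : S) : ℝ :=
  τ * Real.log (∑ a, Real.exp (qValue γ P r v s a / τ))

/-- The softmax policy associated with a state value function. -/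
def softPolicy {S A : Type*} [Fintype S] (γ τ : ℝ) (P : S → A → S → ℝ)
    (r : S → A → ℝ) (v : S → ℝ) (s : S) (a : A) : ℝ :=
  Real.exp ((qValue γ P r v s a - v s) / τ)

lemma sum_mul_le_of_le {S : Type*} [Fintype S] {p f : S → ℝ} {c : ℝ}
    (hp : ∀ s, 0 ≤ p s) (hp1 : ∑ s, p s = 1) (hf : ∀ s, f s ≤ c) :
    ∑ s, p s * f s ≤ c := by
  calc ∑ s, p s * f s ≤ ∑ s, p s * c :=
        Finset.sum_le_sum fun s _ => mul_le_mul_of_nonneg_left (hf s) (hp s)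
    _ = c := by rw [← Finset.sum_mul, hp1, one_mul]

lemma le_sum_mul_of_le {S : Type*} [Fintype S] {p f : S → ℝ} {c : ℝ}
    (hp : ∀ s, 0 ≤ p s) (hp1 : ∑ s, p s = 1) (hf : ∀ s, c ≤ f s) :
    c ≤ ∑ s, p s * f s := by
  have := sum_mul_le_of_le hp hp1 (f := fun s => -f s) fun s => neg_le_neg (hf s)
  simp only [mul_neg, Finset.sum_neg_distrib] at this
  linarith

section SoftBellman

variable {S A : Type*} [Fintype S] [Fintype A] [Nonempty A] {γ τ : ℝ}
  {P : S → A → S → ℝ} {r : S → A → ℝ}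

lemma softBellman_le_of_qValue_le {v w : S → ℝ} {c : ℝ} (hτ : 0 < τ) {s : S}
    (h : ∀ a, qValue γ P r v s a ≤ qValue γ P r w s a + c) :
    softBellman γ τ P r v s ≤ softBellman γ τ P r w s + c := by
  have hpos (u : S → ℝ) : 0 < ∑ a, Real.exp (qValue γ P r u s a / τ) :=
    Finset.sum_pos (fun a _ => Real.exp_pos _) Finset.univ_nonempty
  have hsum : ∑ a, Real.exp (qValue γ P r v s a / τ) ≤
      (∑ a, Real.exp (qValue γ P r w s a / τ)) * Real.exp (c / τ) := by
    rw [Finset.sum_mul]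
    refine Finset.sum_le_sum fun a _ => ?_
    rw [← Real.exp_add, ← add_div]
    exact Real.exp_le_exp.mpr (div_le_div_of_nonneg_right (h a) hτ.le)
  have hlog := Real.log_le_log (hpos v) hsum
  rw [Real.log_mul (hpos w).ne' (Real.exp_pos _).ne', Real.log_exp] at hlog
  calc softBellman γ τ P r v s ≤ τ * (Real.log (∑ a, Real.exp (qValue γ P r w s a / τ)) + c / τ) :=
        mul_le_mul_of_nonneg_left hlog hτ.le
    _ = softBellman γ τ P r w s + c := by rw [softBellman]; field_simp

lemma exists_softBellman_fixedPoint (hγ : γ ∈ Set.Ioo (0 : ℝ) 1) (hτ : 0 < τ)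
    (hP : ∀ s a s', 0 ≤ P s a s') (hP1 : ∀ s a, ∑ s', P s a s' = 1) :
    ∃ v : S → ℝ, softBellman γ τ P r v = v := by
  have key (v w : S → ℝ) (s : S) :
      softBellman γ τ P r v s ≤ softBellman γ τ P r w s + γ * dist v w := by
    refine softBellman_le_of_qValue_le hτ fun a => ?_
    have := sum_mul_le_of_le (hP s a) (hP1 s a) (f := fun s' => v s' - w s') (c := dist v w)
      fun s' => (le_abs_self _).trans (by simpa [Real.dist_eq] using dist_le_pi_dist v w s')
    simp only [mul_sub, Finset.sum_sub_distrib] at this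
    have := mul_le_mul_of_nonneg_left this hγ.1.le
    unfold qValue
    linarith
  have hc : ContractingWith ⟨γ, hγ.1.le⟩ (softBellman γ τ P r) := by
    refine ⟨by exact_mod_cast hγ.2, LipschitzWith.of_dist_le_mul fun v w => ?_⟩
    refine (dist_pi_le_iff (by have := hγ.1; positivity)).mpr fun s => ?_
    rw [Real.dist_eq, abs_le]
    have h₁ := key v w s
    have h₂ := key w v s
    rw [dist_comm] at h₂
    change -(γ * dist v w) ≤ _ ∧ _ ≤ γ * dist v w
    constructor <;> linarith
  exact ⟨_, hc.fixedPoint_isFixedPt⟩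

variable {v : S → ℝ}

lemma sum_softPolicy (hτ : 0 < τ) (hv : softBellman γ τ P r v = v) (s : S) :
    ∑ a, softPolicy γ τ P r v s a = 1 := by
  have hpos : 0 < ∑ a, Real.exp (qValue γ P r v s a / τ) :=
    Finset.sum_pos (fun a _ => Real.exp_pos _) Finset.univ_nonempty
  have hlog : v s / τ = Real.log (∑ a, Real.exp (qValue γ P r v s a / τ)) := by
    have h := congrFun hv s
    rw [softBellman] at h
    rw [← h, mul_div_cancel_left₀ _ hτ.ne']
  simp only [softPolicy, sub_div, Real.exp_sub]
  rw [← Finset.sum_div, hlog, Real.exp_log hpos, div_self hpos.ne']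

lemma fixedPoint_lower_bound [Nonempty S] (hγ : γ ∈ Set.Ioo (0 : ℝ) 1) (hτ : 0 < τ)
    (hP : ∀ s a s', 0 ≤ P s a s') (hP1 : ∀ s a, ∑ s', P s a s' = 1)
    {R : ℝ} (hr : ∀ s a, |r s a| ≤ R) (hv : softBellman γ τ P r v = v) (s : S) :
    -R / (1 - γ) ≤ v s := by
  obtain ⟨s₀, hs₀⟩ := Finite.exists_min v
  obtain ⟨a⟩ := ‹Nonempty A›
  have hq : qValue γ P r v s₀ a ≤ v s₀ := by
    have h1 : softPolicy γ τ P r v s₀ a ≤ 1 := by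
      have : Nonempty A := ⟨a⟩
      rw [← sum_softPolicy hτ hv s₀]
      exact Finset.single_le_sum (f := softPolicy γ τ P r v s₀)
        (fun a _ => (Real.exp_pos _).le) (Finset.mem_univ a)
    rw [softPolicy, Real.exp_le_one_iff, div_nonpos_iff] at h1
    rcases h1 with h1 | h1 <;> linarith
  have hm := mul_le_mul_of_nonneg_left (le_sum_mul_of_le (hP s₀ a) (hP1 s₀ a) hs₀) hγ.1.le
  have hra := (abs_le.mp (hr s₀ a)).1
  refine le_trans ?_ (hs₀ s)
  rw [div_le_iff₀ (by linarith [hγ.2])]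
  unfold qValue at hq
  linarith

lemma fixedPoint_upper_bound [Nonempty S] (hγ : γ ∈ Set.Ioo (0 : ℝ) 1) (hτ : 0 < τ)
    (hP : ∀ s a s', 0 ≤ P s a s') (hP1 : ∀ s a, ∑ s', P s a s' = 1)
    {R : ℝ} (hr : ∀ s a, |r s a| ≤ R) (hv : softBellman γ τ P r v = v) (s : S) :
    v s ≤ (R + τ * Real.log (Fintype.card A)) / (1 - γ) := by
  obtain ⟨s₀, hs₀⟩ := Finite.exists_max v
  have hq (a : A) : qValue γ P r v s₀ a ≤ R + γ * v s₀ := by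
    have hm := mul_le_mul_of_nonneg_left (sum_mul_le_of_le (hP s₀ a) (hP1 s₀ a) hs₀) hγ.1.le
    have hra := (abs_le.mp (hr s₀ a)).2
    unfold qValue
    linarith
  have hsum : (1 : ℝ) ≤ Fintype.card A * Real.exp ((R + γ * v s₀ - v s₀) / τ) := by
    rw [← sum_softPolicy hτ hv s₀, ← nsmul_eq_mul, ← Finset.card_univ]
    refine Finset.sum_le_card_nsmul _ _ _ fun a _ => Real.exp_le_exp.mpr ?_
    exact div_le_div_of_nonneg_right (by linarith [hq a]) hτ.le
  have hcard : (0 : ℝ) < Fintype.card A := by exact_mod_cast Fintype.card_pos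
  have hlog := Real.log_le_log one_pos hsum
  rw [Real.log_one, Real.log_mul hcard.ne' (Real.exp_pos _).ne', Real.log_exp] at hlog
  have hmul := mul_nonneg hτ.le hlog
  rw [mul_add, mul_div_cancel₀ _ hτ.ne'] at hmul
  refine (hs₀ s).trans ?_
  rw [le_div_iff₀ (by linarith [hγ.2])]
  linarith

lemma softPolicy_lower_bound [Nonempty S] (hγ : γ ∈ Set.Ioo (0 : ℝ) 1) (hτ : 0 < τ)
    (hP : ∀ s a s', 0 ≤ P s a s') (hP1 : ∀ s a, ∑ s', P s a s' = 1)
    {R : ℝ} (hr : ∀ s a, |r s a| ≤ R) (hv : softBellman γ τ P r v = v) (s : S) (a : A) :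
    Real.exp (-2 * R / (τ * (1 - γ))) / (Fintype.card A : ℝ) ^ (1 / (1 - γ)) ≤
      softPolicy γ τ P r v s a := by
  have h1γ : 0 < 1 - γ := by linarith [hγ.2]
  have hcard : (0 : ℝ) < Fintype.card A := by exact_mod_cast Fintype.card_pos
  have hq : -R / (1 - γ) ≤ qValue γ P r v s a := by
    have hm := mul_le_mul_of_nonneg_left (le_sum_mul_of_le (hP s a) (hP1 s a)
      (fixedPoint_lower_bound hγ hτ hP hP1 hr hv)) hγ.1.le
    have hra := (abs_le.mp (hr s a)).1
    have : -R / (1 - γ) = -R + γ * (-R / (1 - γ)) := by field_simp; ring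
    unfold qValue
    linarith
  have hv' := fixedPoint_upper_bound hγ hτ hP hP1 hr hv s
  rw [Real.rpow_def_of_pos hcard, ← Real.exp_sub, softPolicy]
  refine Real.exp_le_exp.mpr ?_
  have : -2 * R / (τ * (1 - γ)) - Real.log (Fintype.card A) * (1 / (1 - γ)) =
      (-R / (1 - γ) - (R + τ * Real.log (Fintype.card A)) / (1 - γ)) / τ := by
    field_simp; ring
  rw [this]
  exact div_le_div_of_nonneg_right (by linarith) hτ.le

end SoftBellman

section Discounted

variable {S : Type*} [Fintype S] {γ : ℝ} {K : S → S → ℝ}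

lemma nonneg_of_discounted_sum_le [Nonempty S] (hγ : γ ∈ Set.Ioo (0 : ℝ) 1)
    (hK : ∀ s s', 0 ≤ K s s') (hK1 : ∀ s, ∑ s', K s s' = 1) {v : S → ℝ}
    (hv : ∀ s, γ * ∑ s', K s s' * v s' ≤ v s) (s : S) : 0 ≤ v s := by
  obtain ⟨s₀, hs₀⟩ := Finite.exists_min v
  have hm := mul_le_mul_of_nonneg_left (le_sum_mul_of_le (hK s₀) (hK1 s₀) hs₀) hγ.1.le
  have := hv s₀
  have h1γ : 0 < 1 - γ := by linarith [hγ.2]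
  exact le_trans (by nlinarith) (hs₀ s)

/-- The discounted flow equation of a stochastic kernel has a nonnegative solution. -/
lemma exists_discounted_flow [Nonempty S] (hγ : γ ∈ Set.Ioo (0 : ℝ) 1)
    (hK : ∀ s s', 0 ≤ K s s') (hK1 : ∀ s, ∑ s', K s s' = 1) {b : S → ℝ} (hb : ∀ s, 0 ≤ b s) :
    ∃ ν : S → ℝ, (∀ s, 0 ≤ ν s) ∧ ∀ s', ν s' - γ * ∑ s, K s s' * ν s = b s' := by
  classical
  let M : Matrix S S ℝ := 1 - γ • Matrix.of K
  have hM (v : S → ℝ) (s : S) : M.mulVec v s = v s - γ * ∑ s', K s s' * v s' := by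
    simp only [M, Matrix.sub_mulVec, Matrix.one_mulVec, Matrix.smul_mulVec]
    rfl
  have hinj : Function.Injective M.mulVec := by
    refine (injective_iff_map_eq_zero M.mulVecLin).mpr fun v hv => ?_
    have h0 (s : S) : v s - γ * ∑ s', K s s' * v s' = 0 := by
      rw [← hM]; exact congrFun hv s
    funext s
    refine le_antisymm ?_ (nonneg_of_discounted_sum_le hγ hK hK1 (fun s => by linarith [h0 s]) s)
    have := nonneg_of_discounted_sum_le hγ hK hK1 (v := -v) (fun s => by
      simp only [Pi.neg_apply, mul_neg, Finset.sum_neg_distrib]; linarith [h0 s]) s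
    simpa using this
  have hunit : IsUnit M := Matrix.mulVec_injective_iff_isUnit.mp hinj
  obtain ⟨ν, hν⟩ := Matrix.vecMul_surjective_iff_isUnit.mpr hunit b
  refine ⟨ν, fun s => ?_, fun s' => ?_⟩
  · obtain ⟨v, hv⟩ := Matrix.mulVec_surjective_iff_isUnit.mpr hunit (Pi.single s 1)
    have hv0 (t : S) : 0 ≤ v t := by
      refine nonneg_of_discounted_sum_le hγ hK hK1 (fun u => ?_) t
      have h1 := congrFun hv u
      rw [hM] at h1
      have h2 : (0 : ℝ) ≤ (Pi.single s 1 : S → ℝ) u := by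
        rw [Pi.single_apply]; split_ifs <;> norm_num
      linarith
    have hνs : ν s = b ⬝ᵥ v := by
      rw [← hν, ← Matrix.dotProduct_mulVec, hv]; simp
    rw [hνs]
    exact Finset.sum_nonneg fun t _ => mul_nonneg (hb t) (hv0 t)
  · rw [← hν]
    simp only [M, Matrix.vecMul_sub, Matrix.vecMul_one, Matrix.vecMul_smul, mul_comm (K _ _)]
    rfl

end Discounted

/-- Every policy is induced by an occupancy measure with prescribed disintegration. -/
lemma exists_mem_occSet {S A : Type*} [Fintype S] [Fintype A] [Nonempty S]
    {γ : ℝ} (hγ : γ ∈ Set.Ioo (0 : ℝ) 1) {ν₀ : S → ℝ} (hν₀ : ∀ s, 0 ≤ ν₀ s)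
    {P : S → A → S → ℝ} (hP : ∀ s a s', 0 ≤ P s a s') (hP1 : ∀ s a, ∑ s', P s a s' = 1)
    {q : S → A → ℝ} (hq : ∀ s a, 0 ≤ q s a) (hq1 : ∀ s, ∑ a, q s a = 1) :
    ∃ ν : S → ℝ, (fun s a => ν s * q s a) ∈ occSet γ ν₀ P := by
  obtain ⟨ν, hν, hflow⟩ := exists_discounted_flow hγ (K := fun s s' => ∑ a, q s a * P s a s')
    (fun s s' => Finset.sum_nonneg fun a _ => mul_nonneg (hq s a) (hP s a s'))
    (fun s => by
      rw [Finset.sum_comm]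
      simp_rw [← Finset.mul_sum, hP1, mul_one, hq1])
    (b := fun s => (1 - γ) * ν₀ s)
    (fun s => mul_nonneg (by linarith [hγ.2]) (hν₀ s))
  refine ⟨ν, fun s a => mul_nonneg (hν s) (hq s a), fun s' => ?_⟩
  rw [← hflow s', ← Finset.mul_sum, hq1, mul_one]
  congr 2
  refine Finset.sum_congr rfl fun s _ => ?_
  rw [Finset.sum_mul]
  exact Finset.sum_congr rfl fun a _ => by ring

lemma sum_mul_bellman_residual {S A : Type*} [Fintype S] [Fintype A] {γ : ℝ} {ν₀ : S → ℝ}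
    {P : S → A → S → ℝ} {μ : S → A → ℝ} (hμ : μ ∈ occSet γ ν₀ P) (v : S → ℝ) :
    ∑ s, ∑ a, (v s - γ * ∑ s', P s a s' * v s') * μ s a = (1 - γ) * ∑ s, ν₀ s * v s := by
  have h : ∑ s', ((∑ a, μ s' a) - γ * ∑ s, ∑ a, P s a s' * μ s a) * v s' =
      ∑ s', (1 - γ) * ν₀ s' * v s' := Finset.sum_congr rfl fun s' _ => by rw [hμ.2 s']
  simp only [mul_assoc, ← Finset.mul_sum] at h
  rw [← h]
  simp only [sub_mul, Finset.sum_sub_distrib, mul_assoc, ← Finset.mul_sum]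
  congr 1
  · exact Finset.sum_congr rfl fun s _ => mul_comm _ _
  · congr 1
    simp only [Finset.sum_mul]
    conv_rhs => rw [Finset.sum_comm]
    refine Finset.sum_congr rfl fun s _ => ?_
    conv_rhs => rw [Finset.sum_comm]
    exact Finset.sum_congr rfl fun a _ => Finset.sum_congr rfl fun s' _ => by ring

/-- The pointwise relative entropy density `q - p - p (log q - log p)`. -/
def klDensity (p q : ℝ) : ℝ := q - p - p * (Real.log q - Real.log p)

lemma klDensity_self (p : ℝ) : klDensity p p = 0 := by simp [klDensity]

lemma klDensity_pos {p q : ℝ} (hp : 0 ≤ p) (hq : 0 < q) (hne : p ≠ q) : 0 < klDensity p q := by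
  rcases hp.eq_or_lt with rfl | hp
  · simpa [klDensity] using hq
  · have h := Real.log_lt_sub_one_of_pos (div_pos hq hp)
      (fun h => hne ((div_eq_one_iff_eq hp.ne').mp h).symm)
    rw [Real.log_div hq.ne' hp.ne'] at h
    have h' := mul_lt_mul_of_pos_left h hp
    rw [mul_sub_one, mul_div_cancel₀ _ hp.ne'] at h'
    unfold klDensity
    linarith

lemma klDensity_nonneg {p q : ℝ} (hp : 0 ≤ p) (hq : 0 < q) : 0 ≤ klDensity p q := by
  rcases eq_or_ne p q with rfl | hne
  · exact (klDensity_self p).ge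
  · exact (klDensity_pos hp hq hne).le

/-- The regularized objective equals the optimal value minus a relative entropy to the softmax
policy of the soft Bellman fixed point. -/
lemma Jshannon_eq_sub_klDensity {S A : Type*} [Fintype S] [Fintype A] [Nonempty A]
    {γ τ : ℝ} (hτ : 0 < τ) {ν₀ : S → ℝ} {P : S → A → S → ℝ} {r : S → A → ℝ} {v : S → ℝ}
    (hv : softBellman γ τ P r v = v) {μ : S → A → ℝ} (hμ : μ ∈ occSet γ ν₀ P)
    (hpos : ∀ s, 0 < ∑ a, μ s a) :
    Jshannon τ r μ = (1 - γ) * ∑ s, ν₀ s * v s -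
      τ * ∑ s, (∑ a, μ s a) * ∑ a, klDensity (pol μ s a) (softPolicy γ τ P r v s a) := by
  rw [← sum_mul_bellman_residual hμ v, Jshannon, Finset.mul_sum, ← Finset.sum_sub_distrib,
    ← Finset.sum_sub_distrib]
  refine Finset.sum_congr rfl fun s _ => ?_
  set n := ∑ a, μ s a with hn
  have hμp (a : A) : μ s a = n * pol μ s a := by
    rw [pol, mul_div_cancel₀ _ (hpos s).ne']
  have hp1 : ∑ a, pol μ s a = 1 := by
    simp only [pol]
    rw [← Finset.sum_div, div_self (hpos s).ne']
  have hlog (a : A) : τ * Real.log (softPolicy γ τ P r v s a) = qValue γ P r v s a - v s := by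
    rw [softPolicy, Real.log_exp, mul_div_cancel₀ _ hτ.ne']
  have hkl : ∑ a, klDensity (pol μ s a) (softPolicy γ τ P r v s a) =
      -∑ a, pol μ s a * (Real.log (softPolicy γ τ P r v s a) - Real.log (pol μ s a)) := by
    simp only [klDensity, Finset.sum_sub_distrib, sum_softPolicy hτ hv s, hp1]
    ring
  rw [hkl]
  simp only [hμp, Finset.mul_sum, ← Finset.sum_neg_distrib, ← Finset.sum_sub_distrib]
  refine Finset.sum_congr rfl fun a _ => ?_
  have := hlog a
  unfold qValue at this
  simp only [Finset.mul_sum] at this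
  linear_combination (-n * pol μ s a) * this

/-- A maximizer of the regularized objective induces the softmax policy of the soft Bellman
fixed point. -/
lemma pol_eq_softPolicy_of_maximizer {S A : Type*} [Fintype S] [Fintype A] [Nonempty S]
    [Nonempty A] {γ τ : ℝ} (hγ : γ ∈ Set.Ioo (0 : ℝ) 1) (hτ : 0 < τ) {ν₀ : S → ℝ}
    (hν₀ : ∀ s, 0 ≤ ν₀ s) {P : S → A → S → ℝ} (hP : ∀ s a s', 0 ≤ P s a s')
    (hP1 : ∀ s a, ∑ s', P s a s' = 1) {r : S → A → ℝ} {v : S → ℝ}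
    (hv : softBellman γ τ P r v = v) (hpos : ∀ μ ∈ occSet γ ν₀ P, ∀ s, 0 < ∑ a, μ s a)
    {μ : S → A → ℝ} (hμ : μ ∈ occSet γ ν₀ P)
    (hopt : ∀ μ' ∈ occSet γ ν₀ P, Jshannon τ r μ' ≤ Jshannon τ r μ) (s : S) (a : A) :
    pol μ s a = softPolicy γ τ P r v s a := by
  obtain ⟨ν, hν⟩ := exists_mem_occSet hγ hν₀ hP hP1
    (q := softPolicy γ τ P r v) (fun s a => (Real.exp_pos _).le) (sum_softPolicy hτ hv)
  have hνsum (s : S) : ∑ a, ν s * softPolicy γ τ P r v s a = ν s := by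
    rw [← Finset.mul_sum, sum_softPolicy hτ hv, mul_one]
  have hpol (s : S) (a : A) :
      pol (fun s a => ν s * softPolicy γ τ P r v s a) s a = softPolicy γ τ P r v s a := by
    have := hpos _ hν s
    rw [hνsum] at this
    rw [pol, hνsum, mul_div_cancel_left₀ _ this.ne']
  have hle := hopt _ hν
  rw [Jshannon_eq_sub_klDensity hτ hv hν (hpos _ hν),
    Jshannon_eq_sub_klDensity hτ hv hμ (hpos _ hμ)] at hle
  simp only [hpol, klDensity_self, Finset.sum_const_zero, mul_zero, sub_zero] at hle
  have hkl (s : S) (a : A) : 0 ≤ klDensity (pol μ s a) (softPolicy γ τ P r v s a) :=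
    klDensity_nonneg (div_nonneg (hμ.1 s a) (hpos μ hμ s).le) (Real.exp_pos _)
  by_contra hne
  have : 0 < ∑ s, (∑ a, μ s a) * ∑ a, klDensity (pol μ s a) (softPolicy γ τ P r v s a) := by
    refine Finset.sum_pos' (fun s _ => mul_nonneg (hpos μ hμ s).le
      (Finset.sum_nonneg fun a _ => hkl s a)) ⟨s, Finset.mem_univ s, mul_pos (hpos μ hμ s) ?_⟩
    exact Finset.sum_pos' (fun a _ => hkl s a) ⟨a, Finset.mem_univ a,
      klDensity_pos (div_nonneg (hμ.1 s a) (hpos μ hμ s).le) (Real.exp_pos _) hne⟩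
  have := mul_pos hτ this
  linarith

/-- For Shannon entropy regularization, the optimal policy is lower bounded by
`exp(−2·r_max/(τ·(1−γ))) / |A|^{1 + 1/(1−γ)}`. -/
theorem stmt4 {S A : Type*} [Fintype S] [Fintype A] [Nonempty S] [Nonempty A]
    (hcardS : 1 < Fintype.card S) (hcardA : 1 < Fintype.card A)
    (γ : ℝ) (hγ : γ ∈ Set.Ioo (0 : ℝ) 1)
    (ν₀ : S → ℝ) (hν₀ : (∀ s, 0 ≤ ν₀ s) ∧ ∑ s, ν₀ s = 1)
    (P : S → A → S → ℝ)
    (hP : (∀ s a s', 0 ≤ P s a s') ∧ ∀ s a, ∑ s', P s a s' = 1)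
    (τ : ℝ) (hτ : 0 < τ)
    (r : S → A → ℝ)
    (νmin : ℝ) (hνmin : 0 < νmin)
    (hexp : ∀ μ ∈ occSet γ ν₀ P, ∀ s, νmin ≤ ∑ a, μ s a)
    (μstar : S → A → ℝ) (hmem : μstar ∈ occSet γ ν₀ P)
    (hopt : ∀ μ ∈ occSet γ ν₀ P, Jshannon τ r μ ≤ Jshannon τ r μstar) :
    ∀ s a,
      Real.exp (-2 * (Finset.univ.sup' Finset.univ_nonempty
            fun q : S × A => |r q.1 q.2|) / (τ * (1 - γ))) /
          (Fintype.card A : ℝ) ^ ((1 : ℝ) + 1 / (1 - γ)) ≤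
        pol μstar s a := by
  intro s a
  obtain ⟨v, hv⟩ := exists_softBellman_fixedPoint (r := r) hγ hτ hP.1 hP.2
  rw [pol_eq_softPolicy_of_maximizer hγ hτ hν₀.1 hP.1 hP.2 hv
    (fun μ hμ s => hνmin.trans_le (hexp μ hμ s)) hmem hopt s a]
  refine le_trans ?_ (softPolicy_lower_bound hγ hτ hP.1 hP.2
    (R := Finset.univ.sup' Finset.univ_nonempty fun q : S × A => |r q.1 q.2|)
    (fun s a => Finset.le_sup' (fun q : S × A => |r q.1 q.2|) (Finset.mem_univ (s, a))) hv s a)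
  have hcard : (1 : ℝ) ≤ Fintype.card A := by exact_mod_cast hcardA.le
  refine div_le_div_of_nonneg_left (Real.exp_pos _).le
    (Real.rpow_pos_of_pos (by linarith) _) ?_
  exact Real.rpow_le_rpow_of_exponent_le hcard (by linarith)
end
end

section
/- Fix τ > 0 and define g : {μ ∈ M : μ(s,a) > 0 for all (s,a)} → ℝ^{S×A} by g(μ)(s,a) = τ·log(μ(s,a)/ν(s)) (this is the gradient of h̄ for Shannon entropy regularization h = τ·Σ_a p(a)log p(a)). Let K ⊆ M be a convex set such that ν(s) ≥ ν_min > 0 and π^μ(a|s) ≥ π_min > 0 for all μ ∈ K and all (s,a). Then for all μ₁, μ₂ ∈ K: ‖g(μ₁) − g(μ₂)‖₂ ≤ (τ·|S|·|A| / (ν_min·π_min)) · ‖μ₁ − μ₂‖₂. -/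
noncomputable section
open scoped BigOperators

/-- Euclidean norm on `ℝ^{S×A}`. -/
def l2norm {S A : Type*} [Fintype S] [Fintype A] (x : S → A → ℝ) : ℝ :=
  Real.sqrt (∑ s, ∑ a, (x s a) ^ 2)

/-- The gradient of `h̄` for Shannon entropy regularization:
`g(μ)(s,a) = τ·log(μ(s,a)/ν(s))`. -/
def gradShannon {S A : Type*} [Fintype A] (τ : ℝ) (μ : S → A → ℝ) : S → A → ℝ :=
  fun s a => τ * Real.log (μ s a / ∑ a', μ s a')

/-- The log-ratios `log (x / u)` vary by at most `1 / m` times the variation of `x` and of the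
remainder `u - x`, as long as the first arguments stay above `m`. -/
lemma log_div_sub_log_div_le {x y u v m : ℝ} (hm : 0 < m) (hx : 0 < x) (hy : m ≤ y)
    (hxu : x ≤ u) (hyv : y ≤ v) :
    Real.log (x / u) - Real.log (y / v) ≤ (|x - y| + |(u - x) - (v - y)|) / m := by
  have hu : 0 < u := by linarith
  have hy' : 0 < y := by linarith
  have hv : 0 < v := by linarith
  have hlog := Real.log_le_sub_one_of_pos (div_pos (div_pos hx hu) (div_pos hy' hv))
  rw [Real.log_div (div_pos hx hu).ne' (div_pos hy' hv).ne'] at hlog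
  have hratio : x / u / (y / v) - 1 =
      ((u - x) / u * (x - y) + x / u * ((v - y) - (u - x))) / y := by
    field_simp
    ring
  have hrest : (u - x) / u * (x - y) ≤ |x - y| := by
    have h0 : 0 ≤ (u - x) / u := div_nonneg (by linarith) hu.le
    have h1 : (u - x) / u ≤ 1 := (div_le_one hu).2 (by linarith)
    nlinarith [le_abs_self (x - y), abs_nonneg (x - y)]
  have hfirst : x / u * ((v - y) - (u - x)) ≤ |(u - x) - (v - y)| := by
    have h0 : 0 ≤ x / u := (div_pos hx hu).le
    have h1 : x / u ≤ 1 := (div_le_one hu).2 hxu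
    nlinarith [neg_abs_le ((u - x) - (v - y)), abs_nonneg ((u - x) - (v - y))]
  calc Real.log (x / u) - Real.log (y / v)
      ≤ ((u - x) / u * (x - y) + x / u * ((v - y) - (u - x))) / y := hlog.trans_eq hratio
    _ ≤ (|x - y| + |(u - x) - (v - y)|) / y := by gcongr
    _ ≤ (|x - y| + |(u - x) - (v - y)|) / m := by gcongr

/-- The logarithm of a normalized vector is Lipschitz from the `ℓ¹` norm, with constant `1 / m`
on vectors with entries at least `m`. -/
lemma abs_log_div_sum_sub_le {A : Type*} [Fintype A] {m : ℝ} (hm : 0 < m) {p q : A → ℝ}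
    (hp : ∀ a, m ≤ p a) (hq : ∀ a, m ≤ q a) (a : A) :
    |Real.log (p a / ∑ b, p b) - Real.log (q a / ∑ b, q b)| ≤ (∑ b, |p b - q b|) / m := by
  classical
  have key : ∀ {p q : A → ℝ}, (∀ a, m ≤ p a) → (∀ a, m ≤ q a) →
      Real.log (p a / ∑ b, p b) - Real.log (q a / ∑ b, q b) ≤ (∑ b, |p b - q b|) / m := by
    intro p q hp hq
    have le_sum : ∀ {r : A → ℝ}, (∀ a, m ≤ r a) → r a ≤ ∑ b, r b := fun hr =>
      Finset.single_le_sum (fun b _ => hm.le.trans (hr b)) (Finset.mem_univ a)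
    refine (log_div_sub_log_div_le hm (hm.trans_le (hp a)) (hq a) (le_sum hp) (le_sum hq)).trans ?_
    gcongr
    rw [← Finset.add_sum_erase _ (fun b => |p b - q b|) (Finset.mem_univ a),
      ← Finset.sum_erase_eq_sub (Finset.mem_univ a), ← Finset.sum_erase_eq_sub (Finset.mem_univ a),
      ← Finset.sum_sub_distrib]
    gcongr
    exact Finset.abs_sum_le_sum_abs _ _
  refine abs_le.2 ⟨?_, key hp hq⟩
  have h := key hq hp
  simp_rw [abs_sub_comm (q _)] at h
  linarith

/-- A matrix whose entries are bounded by `c` times the `ℓ¹` norms of the rows of `y` has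
Euclidean norm at most `c * |A|` times that of `y`. -/
lemma l2norm_le_of_abs_le_row_sum {S A : Type*} [Fintype S] [Fintype A] {c : ℝ} (hc : 0 ≤ c)
    {x y : S → A → ℝ} (h : ∀ s a, |x s a| ≤ c * ∑ b, |y s b|) :
    l2norm x ≤ c * Fintype.card A * l2norm y := by
  have hcA : 0 ≤ c * Fintype.card A := by positivity
  unfold l2norm
  rw [← Real.sqrt_sq hcA, ← Real.sqrt_mul (sq_nonneg _), Finset.mul_sum]
  refine Real.sqrt_le_sqrt (Finset.sum_le_sum fun s _ => ?_)
  have hrow : (∑ b, |y s b|) ^ 2 ≤ Fintype.card A * ∑ b, y s b ^ 2 := by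
    simpa using sq_sum_le_card_mul_sum_sq (s := Finset.univ) (f := fun b => |y s b|)
  calc ∑ a, x s a ^ 2
      ≤ ∑ _a : A, c ^ 2 * (Fintype.card A * ∑ b, y s b ^ 2) := by
        refine Finset.sum_le_sum fun a _ => ?_
        calc x s a ^ 2 = |x s a| ^ 2 := (sq_abs _).symm
          _ ≤ (c * ∑ b, |y s b|) ^ 2 := by gcongr; exact h s a
          _ = c ^ 2 * (∑ b, |y s b|) ^ 2 := mul_pow _ _ _
          _ ≤ _ := by gcongr
    _ = (c * Fintype.card A) ^ 2 * ∑ b, y s b ^ 2 := by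
        simp only [Finset.sum_const, Finset.card_univ, nsmul_eq_mul]
        ring

/-- On a convex subset `K ⊆ M` with `ν(s) ≥ ν_min > 0` and
`π^μ(a|s) ≥ π_min > 0`, the Shannon-entropy gradient is Lipschitz with constant
`τ·|S|·|A|/(ν_min·π_min)`. -/
theorem stmt5 {S A : Type*} [Fintype S] [Fintype A]
    (hcardS : 1 < Fintype.card S) (hcardA : 1 < Fintype.card A)
    (γ : ℝ) (hγ : γ ∈ Set.Ioo (0 : ℝ) 1)
    (ν₀ : S → ℝ) (hν₀ : (∀ s, 0 ≤ ν₀ s) ∧ ∑ s, ν₀ s = 1)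
    (P : S → A → S → ℝ)
    (hP : (∀ s a s', 0 ≤ P s a s') ∧ ∀ s a, ∑ s', P s a s' = 1)
    (τ : ℝ) (hτ : 0 < τ)
    (K : Set (S → A → ℝ)) (hK : K ⊆ occSet γ ν₀ P) (hconv : Convex ℝ K)
    (νmin πmin : ℝ) (hνmin : 0 < νmin) (hπmin : 0 < πmin)
    (hν : ∀ μ ∈ K, ∀ s, νmin ≤ ∑ a, μ s a)
    (hπ : ∀ μ ∈ K, ∀ s a, πmin ≤ μ s a / ∑ a', μ s a') :
    ∀ μ₁ ∈ K, ∀ μ₂ ∈ K,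
      l2norm (fun s a => gradShannon τ μ₁ s a - gradShannon τ μ₂ s a) ≤
        τ * Fintype.card S * Fintype.card A / (νmin * πmin) *
          l2norm (fun s a => μ₁ s a - μ₂ s a) := by
  intro μ₁ h₁ μ₂ h₂
  have hm : 0 < νmin * πmin := mul_pos hνmin hπmin
  have hentry : ∀ μ ∈ K, ∀ s a, νmin * πmin ≤ μ s a := by
    intro μ hμ s a
    have hpos : 0 < ∑ a', μ s a' := hνmin.trans_le (hν μ hμ s)
    have h := (le_div_iff₀ hpos).1 (hπ μ hμ s a)
    nlinarith [hν μ hμ s]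
  have hbound := l2norm_le_of_abs_le_row_sum (c := τ / (νmin * πmin)) (by positivity)
    (x := fun s a => gradShannon τ μ₁ s a - gradShannon τ μ₂ s a)
    (y := fun s a => μ₁ s a - μ₂ s a) (fun s a => by
      simp only [gradShannon]
      rw [← mul_sub, abs_mul, abs_of_pos hτ, div_mul_eq_mul_div, mul_div_assoc]
      gcongr
      exact abs_log_div_sum_sub_le hm (hentry μ₁ h₁ s) (hentry μ₂ h₂ s) a)
  refine hbound.trans (mul_le_mul_of_nonneg_right ?_ (Real.sqrt_nonneg _))
  rw [div_mul_eq_mul_div]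
  have hS : (1 : ℝ) ≤ Fintype.card S := by exact_mod_cast hcardS.le
  gcongr
  exact le_mul_of_one_le_right hτ.le hS
end
end

section
/- Fix τ > 0 and define g : {μ ∈ M : μ(s,a) > 0 for all (s,a)} → ℝ^{S×A} by g(μ)(s,a) = −τ·( Σ_{a'} √(μ(s,a')/ν(s)) + √(ν(s)/μ(s,a)) − 2 ) (this is the gradient of h̄ for Tsallis-1/2 entropy regularization h(p) = −2τ·(Σ_a √p(a) − 1)). Let K ⊆ M be a convex set such that ν(s) ≥ ν_min > 0 and π^μ(a|s) ≥ π_min > 0 for all μ ∈ K and all (s,a). Then for all μ₁, μ₂ ∈ K: ‖g(μ₁) − g(μ₂)‖₂ ≤ (τ·|S|·|A| / (ν_min·π_min^{3/2})) · ‖μ₁ − μ₂‖₂. -/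
noncomputable section
open scoped BigOperators

/-- The gradient of `h̄` for Tsallis-1/2 entropy regularization:
`g(μ)(s,a) = −τ·( Σ_{a'} √(μ(s,a')/ν(s)) + √(ν(s)/μ(s,a)) − 2 )`. -/
def gradTsallis {S A : Type*} [Fintype A] (τ : ℝ) (μ : S → A → ℝ) : S → A → ℝ :=
  fun s a => -τ * ((∑ a', Real.sqrt (μ s a' / ∑ a'', μ s a'')) +
    Real.sqrt ((∑ a', μ s a') / μ s a) - 2)

/-- The square root is Lipschitz with constant `1 / (2√c)` on `[c, ∞)`. -/
lemma abs_sqrt_sub_sqrt_le {c p q : ℝ} (hc : 0 < c) (hp : c ≤ p) (hq : c ≤ q) :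
    |√p - √q| ≤ |p - q| / (2 * √c) := by
  have hc' := Real.sqrt_pos.2 hc
  have hp' := Real.sqrt_le_sqrt hp
  have hq' := Real.sqrt_le_sqrt hq
  rw [le_div_iff₀ (by positivity)]
  have h : p - q = (√p - √q) * (√p + √q) := by
    have h₁ := Real.sq_sqrt (hc.le.trans hp)
    have h₂ := Real.sq_sqrt (hc.le.trans hq)
    linear_combination -h₁ + h₂
  rw [h, abs_mul, abs_of_pos (by linarith : 0 < √p + √q)]
  gcongr
  linarith

/-- The map `p ↦ √(p⁻¹)` is Lipschitz with constant `1 / (2 c √c)` on `[c, ∞)`. -/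
lemma abs_sqrt_inv_sub_sqrt_inv_le {c p q : ℝ} (hc : 0 < c) (hp : c ≤ p) (hq : c ≤ q) :
    |√p⁻¹ - √q⁻¹| ≤ |p - q| / (2 * (c * √c)) := by
  have hc' := Real.sqrt_pos.2 hc
  have hp' := Real.sqrt_le_sqrt hp
  have hq' := Real.sqrt_le_sqrt hq
  have hp0 : 0 < √p := hc'.trans_le hp'
  have hq0 : 0 < √q := hc'.trans_le hq'
  have h : √p⁻¹ - √q⁻¹ = -(√p - √q) / (√p * √q) := by
    rw [Real.sqrt_inv, Real.sqrt_inv]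
    field_simp
    ring
  have hcc : c ≤ √p * √q := by
    calc c = √c * √c := (Real.mul_self_sqrt hc.le).symm
      _ ≤ √p * √q := by gcongr
  rw [h, abs_div, abs_neg, abs_of_pos (mul_pos hp0 hq0)]
  calc |√p - √q| / (√p * √q) ≤ (|p - q| / (2 * √c)) / c := by
        gcongr
        exact abs_sqrt_sub_sqrt_le hc hp hq
    _ = |p - q| / (2 * (c * √c)) := by
        field_simp

/-- Normalizing two nonnegative vectors of total mass at least `m` expands the `ℓ¹` distance by a
factor of at most `2 / m`. -/
lemma sum_abs_div_sum_sub_div_sum_le {A : Type*} [Fintype A] {x y : A → ℝ} {m : ℝ} (hm : 0 < m)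
    (hx : m ≤ ∑ a, x a) (hy : m ≤ ∑ a, y a) (hy0 : ∀ a, 0 ≤ y a) :
    ∑ a, |x a / ∑ b, x b - y a / ∑ b, y b| ≤ 2 * (∑ a, |x a - y a|) / m := by
  set X := ∑ b, x b with hX
  set Y := ∑ b, y b with hY
  set L := ∑ a, |x a - y a| with hL
  have hX0 : 0 < X := hm.trans_le hx
  have hY0 : 0 < Y := hm.trans_le hy
  have hL0 : 0 ≤ L := Finset.sum_nonneg fun _ _ => abs_nonneg _
  have hXY : |Y - X| ≤ L := by
    rw [abs_sub_comm, hX, hY, ← Finset.sum_sub_distrib]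
    exact Finset.abs_sum_le_sum_abs _ _
  have key : ∀ a, |x a / X - y a / Y| ≤ (|x a - y a| + y a / Y * L) / X := by
    intro a
    have h : x a / X - y a / Y = ((x a - y a) + y a / Y * (Y - X)) / X := by
      field_simp
      ring
    have hya : 0 ≤ y a / Y := div_nonneg (hy0 a) hY0.le
    rw [h, abs_div, abs_of_pos hX0]
    gcongr
    refine (abs_add_le _ _).trans ?_
    rw [abs_mul, abs_of_nonneg hya]
    gcongr
  calc ∑ a, |x a / X - y a / Y| ≤ ∑ a, (|x a - y a| + y a / Y * L) / X :=
        Finset.sum_le_sum fun a _ => key a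
    _ = (L + (∑ a, y a) / Y * L) / X := by
        rw [← Finset.sum_div, Finset.sum_add_distrib, ← Finset.sum_mul, ← Finset.sum_div]
    _ = 2 * L / X := by
        rw [← hY, div_self hY0.ne', one_mul, two_mul]
    _ ≤ 2 * L / m := by gcongr

/-- Pointwise bound on the variation of the Tsallis-1/2 gradient by the `ℓ¹` distance of the
occupancy measures at the given state. -/
lemma abs_gradTsallis_sub_le {S A : Type*} [Fintype A] {τ m c : ℝ} (hτ : 0 < τ) (hm : 0 < m)
    (hc : 0 < c) {μ₁ μ₂ : S → A → ℝ} {s : S} (h₂ : ∀ a, 0 ≤ μ₂ s a)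
    (hν₁ : m ≤ ∑ a, μ₁ s a) (hν₂ : m ≤ ∑ a, μ₂ s a)
    (hπ₁ : ∀ a, c ≤ μ₁ s a / ∑ b, μ₁ s b) (hπ₂ : ∀ a, c ≤ μ₂ s a / ∑ b, μ₂ s b) (a : A) :
    |gradTsallis τ μ₁ s a - gradTsallis τ μ₂ s a| ≤
      2 * (τ / (m * (c * √c))) * ∑ b, |μ₁ s b - μ₂ s b| := by
  set L := ∑ b, |μ₁ s b - μ₂ s b|
  set p : A → ℝ := fun b => μ₁ s b / ∑ b', μ₁ s b' with hp
  set q : A → ℝ := fun b => μ₂ s b / ∑ b', μ₂ s b' with hq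
  have hc' := Real.sqrt_pos.2 hc
  have hL0 : 0 ≤ L := Finset.sum_nonneg fun _ _ => abs_nonneg _
  have hc1 : c ≤ 1 := by
    refine (hπ₂ a).trans (div_le_one_of_le₀ ?_ (hm.le.trans hν₂))
    exact Finset.single_le_sum (f := μ₂ s) (fun b _ => h₂ b) (Finset.mem_univ a)
  have hT : ∑ b, |p b - q b| ≤ 2 * L / m := sum_abs_div_sum_sub_div_sum_le hm hν₁ hν₂ h₂
  have hTa : |p a - q a| ≤ 2 * L / m :=
    (Finset.single_le_sum (f := fun b => |p b - q b|) (fun _ _ => abs_nonneg _)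
      (Finset.mem_univ a)).trans hT
  have hsum : |∑ b, (√(p b) - √(q b))| ≤ L / (m * (c * √c)) := by
    calc |∑ b, (√(p b) - √(q b))| ≤ ∑ b, |p b - q b| / (2 * √c) :=
          (Finset.abs_sum_le_sum_abs _ _).trans
            (Finset.sum_le_sum fun b _ => abs_sqrt_sub_sqrt_le hc (hπ₁ b) (hπ₂ b))
      _ ≤ (2 * L / m) / (2 * √c) := by
          rw [← Finset.sum_div]
          gcongr
      _ = L / (m * (1 * √c)) := by
          field_simp
      _ ≤ L / (m * (c * √c)) := by gcongr
  have hinv : |√(p a)⁻¹ - √(q a)⁻¹| ≤ L / (m * (c * √c)) := by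
    calc |√(p a)⁻¹ - √(q a)⁻¹| ≤ |p a - q a| / (2 * (c * √c)) :=
          abs_sqrt_inv_sub_sqrt_inv_le hc (hπ₁ a) (hπ₂ a)
      _ ≤ (2 * L / m) / (2 * (c * √c)) := by gcongr
      _ = L / (m * (c * √c)) := by
          field_simp
  have h : gradTsallis τ μ₁ s a - gradTsallis τ μ₂ s a =
      -τ * (∑ b, (√(p b) - √(q b)) + (√(p a)⁻¹ - √(q a)⁻¹)) := by
    simp only [gradTsallis, hp, hq, inv_div, Finset.sum_sub_distrib]
    ring
  rw [h, abs_mul, abs_neg, abs_of_pos hτ]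
  calc τ * |∑ b, (√(p b) - √(q b)) + (√(p a)⁻¹ - √(q a)⁻¹)|
      ≤ τ * (L / (m * (c * √c)) + L / (m * (c * √c))) := by
        gcongr
        exact (abs_add_le _ _).trans (add_le_add hsum hinv)
    _ = 2 * (τ / (m * (c * √c))) * L := by ring

/-- A pointwise bound by the `ℓ¹` norms of the rows gives a bound of Euclidean norms. -/
lemma l2norm_le_of_abs_le_sum_abs {S A : Type*} [Fintype S] [Fintype A] {x d : S → A → ℝ} {C : ℝ}
    (hC : 0 ≤ C) (h : ∀ s a, |x s a| ≤ C * ∑ b, |d s b|) :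
    l2norm x ≤ C * Fintype.card A * l2norm d := by
  unfold l2norm
  refine Real.sqrt_le_iff.2 ⟨by positivity, ?_⟩
  rw [mul_pow, Real.sq_sqrt (Finset.sum_nonneg fun _ _ => Finset.sum_nonneg fun _ _ =>
    sq_nonneg _), Finset.mul_sum]
  refine Finset.sum_le_sum fun s _ => ?_
  have hcs : (∑ b, |d s b|) ^ 2 ≤ Fintype.card A * ∑ b, d s b ^ 2 := by
    simpa using sq_sum_le_card_mul_sum_sq (s := Finset.univ) (f := fun b => |d s b|)
  calc ∑ a, x s a ^ 2 ≤ ∑ _a : A, C ^ 2 * (Fintype.card A * ∑ b, d s b ^ 2) := by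
        refine Finset.sum_le_sum fun a _ => ?_
        rw [← sq_abs]
        calc |x s a| ^ 2 ≤ (C * ∑ b, |d s b|) ^ 2 := by
              gcongr
              exact h s a
          _ ≤ C ^ 2 * (Fintype.card A * ∑ b, d s b ^ 2) := by
              rw [mul_pow]
              gcongr
    _ = (C * Fintype.card A) ^ 2 * ∑ b, d s b ^ 2 := by
        rw [Finset.sum_const, Finset.card_univ, nsmul_eq_mul]
        ring

/-- On a convex subset `K ⊆ M` with `ν(s) ≥ ν_min > 0` and
`π^μ(a|s) ≥ π_min > 0`, the Tsallis-1/2 entropy gradient is Lipschitz with constant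
`τ·|S|·|A|/(ν_min·π_min^{3/2})`. -/
theorem stmt6 {S A : Type*} [Fintype S] [Fintype A]
    (hcardS : 1 < Fintype.card S) (hcardA : 1 < Fintype.card A)
    (γ : ℝ) (hγ : γ ∈ Set.Ioo (0 : ℝ) 1)
    (ν₀ : S → ℝ) (hν₀ : (∀ s, 0 ≤ ν₀ s) ∧ ∑ s, ν₀ s = 1)
    (P : S → A → S → ℝ)
    (hP : (∀ s a s', 0 ≤ P s a s') ∧ ∀ s a, ∑ s', P s a s' = 1)
    (τ : ℝ) (hτ : 0 < τ)
    (K : Set (S → A → ℝ)) (hK : K ⊆ occSet γ ν₀ P) (hconv : Convex ℝ K)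
    (νmin πmin : ℝ) (hνmin : 0 < νmin) (hπmin : 0 < πmin)
    (hν : ∀ μ ∈ K, ∀ s, νmin ≤ ∑ a, μ s a)
    (hπ : ∀ μ ∈ K, ∀ s a, πmin ≤ μ s a / ∑ a', μ s a') :
    ∀ μ₁ ∈ K, ∀ μ₂ ∈ K,
      l2norm (fun s a => gradTsallis τ μ₁ s a - gradTsallis τ μ₂ s a) ≤
        τ * Fintype.card S * Fintype.card A / (νmin * πmin ^ ((3 : ℝ) / 2)) *
          l2norm (fun s a => μ₁ s a - μ₂ s a) := by
  intro μ₁ h₁ μ₂ h₂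
  have hpow : πmin ^ ((3 : ℝ) / 2) = πmin * √πmin := by
    rw [Real.sqrt_eq_rpow, ← Real.rpow_one_add' hπmin.le (by norm_num)]
    norm_num
  have hS : (2 : ℝ) ≤ Fintype.card S := by exact_mod_cast hcardS
  have hr := Real.sqrt_pos.2 hπmin
  have hd : 0 ≤ l2norm fun s a => μ₁ s a - μ₂ s a := Real.sqrt_nonneg _
  rw [hpow]
  calc _ ≤ 2 * (τ / (νmin * (πmin * √πmin))) * Fintype.card A *
          l2norm (fun s a => μ₁ s a - μ₂ s a) :=
        l2norm_le_of_abs_le_sum_abs (by positivity) fun s a =>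
          abs_gradTsallis_sub_le hτ hνmin hπmin ((hK h₂).1 s) (hν μ₁ h₁ s) (hν μ₂ h₂ s)
            (hπ μ₁ h₁ s) (hπ μ₂ h₂ s) a
    _ ≤ Fintype.card S * (τ / (νmin * (πmin * √πmin))) * Fintype.card A *
          l2norm (fun s a => μ₁ s a - μ₂ s a) := by gcongr
    _ = _ := by ring
end
end
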